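/- Let 1 ≤ r ≤ q < ∞, let P ⊆ F and R ⊆ G be subspaces, and let T : P → E be a continuous linear operator that is (r,R)-summing with respect to B, with constant K. Then T is (q,R)-summing with respect to B (with the same constant K). -/

import Mathlib

open scoped BigOperators

noncomputable section

variable {F G X E : Type*}
variable [NormedAddCommGroup F] [NormedSpace ℝ F] [CompleteSpace F]
variable [NormedAddCommGroup G] [NormedSpace ℝ G] [CompleteSpace G]
variable [NormedAddCommGroup X] [NormedSpace ℝ X] [CompleteSpace X]
variable [NormedAddCommGroup E] [NormedSpace ℝ E] [CompleteSpace E]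

/-- The closed unit ball of a subspace `R`. -/
def subBall {H : Type*} [NormedAddCommGroup H] [NormedSpace ℝ H] (R : Submodule ℝ H) :
    Set H := {g | g ∈ R ∧ ‖g‖ ≤ 1}

/-- A continuous linear operator `T : P → E` is `(q,R)`-summing with respect to the
continuous bilinear map `B : F × G → X`, with constant `K`, if for every finite family
`f_1, …, f_n ∈ P` one has
`(Σ ‖T f_i‖^q)^(1/q) ≤ K · sup_{g ∈ R, ‖g‖ ≤ 1} (Σ ‖B(f_i,g)‖^q)^(1/q)`. -/
def IsSumming (B : F →L[ℝ] G →L[ℝ] X) (P : Submodule ℝ F) (R : Submodule ℝ G)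
    (q : ℝ) (T : P →L[ℝ] E) (K : ℝ) : Prop :=
  ∀ (n : ℕ) (f : Fin n → P),
    (∑ i, ‖T (f i)‖ ^ q) ^ (1 / q) ≤
      K * sSup ((fun g => (∑ i, ‖B (f i : F) g‖ ^ q) ^ (1 / q)) '' subBall R)

/-- Hölder's inequality for the weights `a i ^ (q / r - 1)`. -/
theorem weighted_Lr_le_Lq {ι : Type*} (s : Finset ι) {r q : ℝ} (hr : 0 < r) (hrq : r < q)
    {a b : ι → ℝ} (ha : ∀ i, 0 ≤ a i) (hb : ∀ i, 0 ≤ b i) :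
    (∑ i ∈ s, (a i ^ (q / r - 1) * b i) ^ r) ^ (1 / r) ≤
      (∑ i ∈ s, a i ^ q) ^ (1 / r - 1 / q) * (∑ i ∈ s, b i ^ q) ^ (1 / q) := by
  have hq : 0 < q := hr.trans hrq
  have hqr : 0 < q - r := sub_pos.2 hrq
  have hconj : (q / (q - r)).HolderConjugate (q / r) := by
    rw [Real.holderConjugate_iff]
    refine ⟨(one_lt_div hqr).2 (by linarith), ?_⟩
    field_simp
    ring
  have hA : 0 ≤ ∑ i ∈ s, a i ^ q := Finset.sum_nonneg fun i _ => Real.rpow_nonneg (ha i) q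
  have hB : 0 ≤ ∑ i ∈ s, b i ^ q := Finset.sum_nonneg fun i _ => Real.rpow_nonneg (hb i) q
  have hpow : ∀ i, (a i ^ (q / r - 1) * b i) ^ r = a i ^ (q - r) * b i ^ r := fun i => by
    rw [Real.mul_rpow (Real.rpow_nonneg (ha i) _) (hb i), ← Real.rpow_mul (ha i)]
    congr 2
    field_simp
  have hholder := Real.inner_le_Lp_mul_Lq_of_nonneg s hconj
    (f := fun i => a i ^ (q - r)) (g := fun i => b i ^ r)
    (fun i _ => Real.rpow_nonneg (ha i) _) (fun i _ => Real.rpow_nonneg (hb i) _)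
  have hfa : ∀ i, (a i ^ (q - r)) ^ (q / (q - r)) = a i ^ q := fun i => by
    rw [← Real.rpow_mul (ha i), mul_div_cancel₀ _ hqr.ne']
  have hgb : ∀ i, (b i ^ r) ^ (q / r) = b i ^ q := fun i => by
    rw [← Real.rpow_mul (hb i), mul_div_cancel₀ _ hr.ne']
  simp only [hfa, hgb] at hholder
  simp only [hpow]
  calc (∑ i ∈ s, a i ^ (q - r) * b i ^ r) ^ (1 / r)
      ≤ ((∑ i ∈ s, a i ^ q) ^ (1 / (q / (q - r))) *
          (∑ i ∈ s, b i ^ q) ^ (1 / (q / r))) ^ (1 / r) :=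
        Real.rpow_le_rpow (Finset.sum_nonneg fun i _ =>
          mul_nonneg (Real.rpow_nonneg (ha i) _) (Real.rpow_nonneg (hb i) _)) hholder
          (by positivity)
    _ = (∑ i ∈ s, a i ^ q) ^ (1 / r - 1 / q) * (∑ i ∈ s, b i ^ q) ^ (1 / q) := by
        rw [Real.mul_rpow (Real.rpow_nonneg hA _) (Real.rpow_nonneg hB _),
          ← Real.rpow_mul hA, ← Real.rpow_mul hB]
        congr 2 <;> field_simp

/-- The functions whose supremum defines `IsSumming` are bounded on `subBall R`. -/
theorem bddAbove_image_subBall (B : F →L[ℝ] G →L[ℝ] X) (R : Submodule ℝ G) {q : ℝ}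
    (hq : 0 ≤ q) {ι : Type*} (s : Finset ι) (f : ι → F) :
    BddAbove ((fun g => (∑ i ∈ s, ‖B (f i) g‖ ^ q) ^ (1 / q)) '' subBall R) := by
  refine ⟨(∑ i ∈ s, ‖B (f i)‖ ^ q) ^ (1 / q), ?_⟩
  rintro _ ⟨g, hg, rfl⟩
  refine Real.rpow_le_rpow (Finset.sum_nonneg fun i _ => by positivity)
    (Finset.sum_le_sum fun i _ => Real.rpow_le_rpow (norm_nonneg _) ?_ hq) (by positivity)
  exact (B (f i)).unit_le_opNorm g hg.2

/-- If `1 ≤ r ≤ q < ∞` and `T : P → E` is `(r,R)`-summing with respect to `B` with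
constant `K`, then `T` is `(q,R)`-summing with respect to `B` with the same constant `K`. -/
theorem summing_mono (B : F →L[ℝ] G →L[ℝ] X) (P : Submodule ℝ F) (R : Submodule ℝ G)
    (r q K : ℝ) (hr : 1 ≤ r) (hrq : r ≤ q) (hK : 0 ≤ K)
    (T : P →L[ℝ] E) (hT : IsSumming B P R r T K) :
    IsSumming B P R q T K := by
  obtain rfl | hlt := hrq.eq_or_lt
  · exact hT
  have hr0 : 0 < r := by linarith
  have hq0 : 0 < q := hr0.trans hlt
  intro n f
  set S := sSup ((fun g => (∑ i, ‖B (f i : F) g‖ ^ q) ^ (1 / q)) '' subBall R) with hS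
  set A := ∑ i, ‖T (f i)‖ ^ q with hA
  have hbdd := bddAbove_image_subBall B R hq0.le Finset.univ fun i => (f i : F)
  have hzero : (0 : G) ∈ subBall R := ⟨R.zero_mem, by simp⟩
  have hS0 : 0 ≤ S := Real.sSup_nonneg (by
    rintro _ ⟨g, -, rfl⟩
    positivity)
  have hA0 : 0 ≤ A := Finset.sum_nonneg fun i _ => by positivity
  obtain hA1 | hA1 := hA0.eq_or_lt
  · rw [← hA1, Real.zero_rpow (by positivity)]
    positivity
  have hscaled := hT n fun i => ‖T (f i)‖ ^ (q / r - 1) • f i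
  have hleft : ∀ i, ‖T (‖T (f i)‖ ^ (q / r - 1) • f i)‖ ^ r = ‖T (f i)‖ ^ q := fun i => by
    rw [map_smul, norm_smul, Real.norm_of_nonneg (by positivity),
      ← Real.rpow_add_one' (norm_nonneg _) (by rw [sub_add_cancel]; positivity),
      sub_add_cancel, ← Real.rpow_mul (norm_nonneg _), div_mul_cancel₀ _ hr0.ne']
  simp only [hleft] at hscaled
  have hright : sSup ((fun g => (∑ i, ‖B ((‖T (f i)‖ ^ (q / r - 1) • f i : P) : F) g‖ ^ r) ^
      (1 / r)) '' subBall R) ≤ A ^ (1 / r - 1 / q) * S := by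
    refine csSup_le ⟨_, 0, hzero, rfl⟩ ?_
    rintro _ ⟨g, hg, rfl⟩
    have hnorm : ∀ i, ‖B ((‖T (f i)‖ ^ (q / r - 1) • f i : P) : F) g‖ =
        ‖T (f i)‖ ^ (q / r - 1) * ‖B (f i : F) g‖ := fun i => by
      rw [Submodule.coe_smul, map_smul, smul_apply, norm_smul,
        Real.norm_of_nonneg (by positivity)]
    simp only [hnorm]
    exact (weighted_Lr_le_Lq _ hr0 hlt (fun i => norm_nonneg (T (f i)))
      (fun i => norm_nonneg (B (f i : F) g))).trans
      (mul_le_mul_of_nonneg_left (le_csSup hbdd ⟨g, hg, rfl⟩) (by positivity))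
  have hmul : A ^ (1 / r - 1 / q) * A ^ (1 / q) ≤ A ^ (1 / r - 1 / q) * (K * S) := by
    rw [← Real.rpow_add hA1, sub_add_cancel]
    calc A ^ (1 / r) ≤ K * (A ^ (1 / r - 1 / q) * S) :=
          hscaled.trans (mul_le_mul_of_nonneg_left hright hK)
      _ = A ^ (1 / r - 1 / q) * (K * S) := by ring
  exact le_of_mul_le_mul_left hmul (Real.rpow_pos_of_pos hA1 _)
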